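/- arXiv:1204.2810 — 8 statements merged into one kernel-verified Lean document; each statement's English description precedes it below -/
import Mathlib

section
/- Suppose every vertex of Γ has degree at most k and that there are only finitely many G-orbits of edges of Γ. Then there exists a G-invariant Borel probability measure ν on the space of (k+1)-labelings V → Fin (k+1) such that ν(B_e) = 0 for every edge e of Γ (i.e., ν is a G-invariant probability measure supported on the proper (k+1)-colorings of Γ). -/
open MeasureTheory

namespace InvCol

open Filter Topology unitInterval

section Ext
variable {V F Ω : Type} [TopologicalSpace F] [DiscreteTopology F] [Finite F]
  [MeasurableSpace F] [DiscreteMeasurableSpace F] [MeasurableSpace Ω]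

lemma meas_comp (c : V → Ω → F) (hc : ∀ v, Measurable (c v)) (f : C(V → F, ℝ)) :
    Measurable (fun ω => f (fun v => c v ω)) := by
  let A : Subalgebra ℝ C(V → F, ℝ) :=
    { carrier := {f | Measurable (fun ω => f (fun v => c v ω))}
      mul_mem' := fun {a b} ha hb => by
        exact Measurable.mul ha hb
      add_mem' := fun {a b} ha hb => by
        exact Measurable.add ha hb
      algebraMap_mem' := fun r => by
        simp [measurable_const] }
  have hA : A.SeparatesPoints := by
    classical
    intro x y hxy
    obtain ⟨v, hv⟩ := Function.ne_iff.mp hxy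
    let h : C(V → F, ℝ) := ⟨fun z => if z v = x v then 1 else 0,
      (continuous_of_discreteTopology (f := fun t : F => if t = x v then (1:ℝ) else 0)).comp
        (continuous_apply v)⟩
    refine ⟨h, ⟨h, ?_, rfl⟩, ?_⟩
    · exact (Measurable.of_discrete (f := fun t : F => if t = x v then (1:ℝ) else 0)).comp (hc v)
    · simp [h, Ne.symm hv]
  have key : ∀ n : ℕ, ∃ g : A, ‖(g : C(V → F, ℝ)) - f‖ < 1 / ((n : ℝ) + 1) := fun n =>
    ContinuousMap.exists_mem_subalgebra_near_continuousMap_of_separatesPoints A hA f _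
      Nat.one_div_pos_of_nat
  choose g hg using key
  refine measurable_of_tendsto_metrizable (f := fun n ω => (g n : C(V → F, ℝ)) (fun v => c v ω))
    (fun n => (g n).2) ?_
  rw [tendsto_pi_nhds]
  intro ω
  rw [tendsto_iff_norm_sub_tendsto_zero]
  refine squeeze_zero (fun _ => norm_nonneg _) (fun n => ?_) tendsto_one_div_add_atTop_nhds_zero_nat
  exact (ContinuousMap.norm_coe_le_norm ((g n : C(V → F, ℝ)) - f) _).trans (hg n).le

lemma integ_comp (P : Measure Ω) [IsProbabilityMeasure P] (c : V → Ω → F)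
    (hc : ∀ v, Measurable (c v)) (f : C(V → F, ℝ)) :
    Integrable (fun ω => f (fun v => c v ω)) P :=
  Integrable.of_bound (meas_comp c hc f).aestronglyMeasurable ‖f‖
    (Eventually.of_forall fun _ => ContinuousMap.norm_coe_le_norm f _)

lemma exists_ext [mX : MeasurableSpace (V → F)] [BorelSpace (V → F)]
    (P : Measure Ω) [IsProbabilityMeasure P] (c : V → Ω → F) (hc : ∀ v, Measurable (c v)) :
    ∃ ν : @Measure (V → F) mX, ν.Regular ∧ IsFiniteMeasure ν ∧
      ∀ f : C(V → F, ℝ), ∫ x, f x ∂ν = ∫ ω, f (fun v => c v ω) ∂P := by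
  let Λ : CompactlySupportedContinuousMap (V → F) ℝ →ₚ[ℝ] ℝ :=
  { toFun g := ∫ ω, g (fun v => c v ω) ∂P
    map_add' g g' := integral_add (integ_comp P c hc g) (integ_comp P c hc g')
    map_smul' r g := integral_smul r _
    monotone' g g' hgg' := integral_mono (integ_comp P c hc g) (integ_comp P c hc g')
      (fun ω => hgg' _) }
  refine ⟨RealRMK.rieszMeasure Λ, inferInstance, inferInstance, fun g ↦ ?_⟩
  let g' : CompactlySupportedContinuousMap (V → F) ℝ :=
  { toFun := g
    hasCompactSupport' := HasCompactSupport.of_compactSpace _ }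
  exact (RealRMK.integral_rieszMeasure Λ g')

end Ext

section Greedy
variable {V : Type} (Γ : SimpleGraph V) (k : ℕ)

noncomputable def pick (S : Set (Fin (k+1))) : Fin (k+1) :=
  open Classical in if h : ∃ i, i ∉ S then h.choose else 0

lemma pick_notMem (S : Set (Fin (k+1))) (h : ∃ i, i ∉ S) : pick k S ∉ S := by
  rw [pick, dif_pos h]; exact h.choose_spec

/-- greedy approximations -/
noncomputable def col : ℕ → V → (V → I) → Fin (k+1)
  | 0, _, _ => 0
  | n+1, v, x => pick k {i | ∃ u ∈ Γ.neighborSet v, x u < x v ∧ col n u x = i}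

/-- no descending path of length `n` from `v` -/
def Stl : ℕ → V → (V → I) → Prop
  | 0, _, _ => False
  | n+1, v, x => ∀ u ∈ Γ.neighborSet v, x u < x v → Stl n u x

lemma col_stable (n : ℕ) : ∀ (v : V) (x : V → I), Stl Γ n v x → ∀ m, n ≤ m →
    col Γ k m v x = col Γ k n v x := by
  induction n with
  | zero => intro v x h; exact h.elim
  | succ n ih =>
    intro v x h m hm
    obtain ⟨m, rfl⟩ : ∃ m', m = m' + 1 := ⟨m - 1, by omega⟩
    simp only [col]
    congr 1
    ext i
    constructor
    · rintro ⟨u, hu, hlt, he⟩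
      exact ⟨u, hu, hlt, by rw [← he, ih u x (h u hu hlt) m (by omega)]⟩
    · rintro ⟨u, hu, hlt, he⟩
      exact ⟨u, hu, hlt, by rw [← he, ih u x (h u hu hlt) m (by omega)]⟩

variable (hdeg : ∀ v : V, (Γ.neighborSet v).Finite ∧ (Γ.neighborSet v).ncard ≤ k)

include hdeg

lemma col_meas (n : ℕ) : ∀ v : V, Measurable (col Γ k n v) := by
  induction n with
  | zero => intro v; exact measurable_const
  | succ n ih =>
    intro v
    have : Measurable (fun x : V → I =>
        ({i | ∃ u ∈ Γ.neighborSet v, x u < x v ∧ col Γ k n u x = i} : Set (Fin (k+1)))) := by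
      rw [measurable_set_iff]
      intro i
      apply measurableSet_setOfPred.mp
      have : {x : V → I | i ∈ {i | ∃ u ∈ Γ.neighborSet v, x u < x v ∧ col Γ k n u x = i}}
          = ⋃ u ∈ Γ.neighborSet v, ({x | x u < x v} ∩ (col Γ k n u) ⁻¹' {i}) := by
        ext x; simp; grind
      rw [this]
      refine Set.Finite.measurableSet_biUnion (hdeg v).1 fun u _ => ?_
      exact (measurableSet_lt (measurable_pi_apply u) (measurable_pi_apply v)).inter
        (ih u (measurableSet_singleton i))
    exact (measurable_of_countable (pick k)).comp this

lemma col_ne (n : ℕ) (u v : V) (x : V → I) (h : Γ.Adj v u) (hlt : x u < x v) :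
    col Γ k (n+1) v x ≠ col Γ k n u x := by
  intro he
  have := pick_notMem k {i | ∃ u ∈ Γ.neighborSet v, x u < x v ∧ col Γ k n u x = i} ?_
  · exact this ⟨u, h, hlt, he.symm⟩
  · by_contra hcon
    push Not at hcon
    have hsub : (Set.univ : Set (Fin (k+1))) ⊆ (fun u => col Γ k n u x) '' Γ.neighborSet v := by
      intro i _
      obtain ⟨u, hu, _, h⟩ := hcon i
      exact ⟨u, hu, h⟩
    have h1 := Set.ncard_le_ncard hsub ((hdeg v).1.image _)
    have h2 := Set.ncard_image_le (f := fun u => col Γ k n u x) (hdeg v).1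
    have h3 := (hdeg v).2
    rw [Set.ncard_univ, Nat.card_eq_fintype_card, Fintype.card_fin] at h1
    omega

lemma paths (n : ℕ) : ∀ v : V, ∃ W : Finset (Fin (n+1) → V), W.card ≤ k ^ n ∧
    ∀ x : V → I, ¬ Stl Γ n v x → ∃ w ∈ W, w 0 = v ∧ StrictAnti (fun i => x (w i)) := by
  classical
  induction n with
  | zero =>
    intro v
    refine ⟨{fun _ => v}, by simp, fun x _ => ⟨_, Finset.mem_singleton_self _, rfl, ?_⟩⟩
    intro i j hij; exact absurd hij (by omega)
  | succ n ih =>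
    intro v
    choose W hW1 hW2 using ih
    refine ⟨(hdeg v).1.toFinset.biUnion fun u => (W u).image (fun w => Matrix.vecCons v w), ?_, ?_⟩
    · refine (Finset.card_biUnion_le_card_mul _ _ (k ^ n) fun u _ =>
        Finset.card_image_le.trans (hW1 u)).trans ?_
      rw [pow_succ', ← Set.ncard_eq_toFinset_card _ (hdeg v).1]
      exact Nat.mul_le_mul_right _ (hdeg v).2
    · intro x hx
      simp only [Stl, not_forall] at hx
      obtain ⟨u, hu, hlt, hs⟩ := hx
      obtain ⟨w, hw, hw0, hwa⟩ := hW2 u x hs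
      refine ⟨Matrix.vecCons v w, ?_, rfl, ?_⟩
      · simp only [Finset.mem_biUnion, Finset.mem_image]
        exact ⟨u, by simpa using hu, w, hw, rfl⟩
      · have : (fun i => x (Matrix.vecCons v w i)) = Matrix.vecCons (x v) (fun i => x (w i)) := by
          ext i; refine Fin.cases ?_ (fun j => ?_) i <;> simp
        rw [this, strictAnti_vecCons]
        exact ⟨by rw [hw0]; exact hlt, hwa⟩

omit hdeg

noncomputable def P (V : Type) : Measure (V → I) := Measure.infinitePi (fun _ : V => (volume : Measure I))

instance : IsProbabilityMeasure (P V) := by unfold P; infer_instance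

lemma P_map {f : V → V} (hf : Function.Injective f) :
    (P V).map (fun x v => x (f v)) = P V :=
  Measure.map_infinitePi_infinitePi_of_inj (P := fun _ : V => (volume : Measure I)) hf

lemma P_tie {u v : V} (h : u ≠ v) : P V {x | x u = x v} = 0 := by
  have h1 := Measure.infinitePi_map_eval_prod (P := fun _ : V => (volume : Measure I)) h
  have hm : MeasurableSet {p : I × I | p.1 = p.2} := measurableSet_eq_fun measurable_fst measurable_snd
  have : P V {x | x u = x v} = ((P V).map (fun x => (x u, x v))) {p : I × I | p.1 = p.2} := by
    rw [Measure.map_apply (by fun_prop) hm]; rfl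
  rw [this, P, h1, Measure.measure_prod_null hm]
  refine Eventually.of_forall fun a => ?_
  have : (Prod.mk a ⁻¹' {p : I × I | p.1 = p.2}) = {a} := by
    ext b; simp [eq_comm]
  change volume (Prod.mk a ⁻¹' {p : I × I | p.1 = p.2}) = 0
  rw [this]; simp

lemma P_anti (n : ℕ) (w : Fin (n+1) → V) :
    P V {x | StrictAnti (fun i => x (w i))} ≤ ((n+1).factorial : ENNReal)⁻¹ := by
  by_cases hw : Function.Injective w
  swap
  · have : {x : V → I | StrictAnti (fun i => x (w i))} = ∅ := by
      ext x
      simp only [Set.mem_ofPred_eq, Set.mem_empty_iff_false, iff_false]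
      intro h
      exact hw (Function.Injective.of_comp (f := x) h.injective)
    simp [this]
  let A : Equiv.Perm (Fin (n+1)) → Set (V → I) := fun ρ => {x | StrictAnti (fun i => x (w (ρ i)))}
  have hA : ∀ ρ, MeasurableSet (A ρ) := by
    intro ρ
    have : A ρ = ⋂ i : Fin n, {x | x (w (ρ i.succ)) < x (w (ρ i.castSucc))} := by
      ext x
      simp [A, Fin.strictAnti_iff_succ_lt]
    rw [this]
    exact MeasurableSet.iInter fun i =>
      measurableSet_lt (measurable_pi_apply _) (measurable_pi_apply _)
  have hm : ∀ ρ, P V (A ρ) = P V (A 1) := by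
    intro ρ
    let τ := ρ.viaEmbedding ⟨w, hw⟩
    have hτ : ∀ i, τ (w i) = w (ρ i) := fun i => ρ.viaEmbedding_apply ⟨w, hw⟩ i
    conv_rhs => rw [← P_map τ.injective, Measure.map_apply (by fun_prop) (hA 1)]
    congr 1
    ext x
    simp [A, hτ]
  have hd : Pairwise (Function.onFun Disjoint A) := by
    intro ρ τ hst
    rw [Function.onFun, Set.disjoint_left]
    intro x hx hy
    apply hst
    -- x ∘ w ∘ ρ and x ∘ w ∘ τ are strictly anti with same range
    have h1 : StrictAnti (fun i => x (w (ρ i))) := hx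
    have h2 : StrictAnti (fun i => x (w (τ i))) := hy
    have hmono : StrictMono (fun i => τ.symm (ρ i)) := by
      intro i j hij
      have := h1 hij
      rw [← h2.lt_iff_gt]
      simpa using this
    have : (fun i => τ.symm (ρ i)) = id := by
      have := Subsingleton.elim (hmono.orderIsoOfSurjective _ (ρ.trans τ.symm).surjective)
        (OrderIso.refl (Fin (n+1)))
      funext i
      exact congrArg (fun e : Fin (n+1) ≃o Fin (n+1) => e i) this
    ext i
    have := congrFun this i
    simp only [id] at this
    rw [Equiv.symm_apply_eq] at this
    rw [this]
  have hs : ∑ ρ, P V (A ρ) ≤ 1 := by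
    have h := measure_iUnion (μ := P V) hd hA
    rw [tsum_fintype] at h
    rw [← h]
    exact prob_le_one
  simp only [hm, Finset.sum_const, Finset.card_univ, Fintype.card_perm, Fintype.card_fin,
    nsmul_eq_mul] at hs
  have : P V (A 1) ≤ ((n+1).factorial : ENNReal)⁻¹ := by
    rw [ENNReal.le_inv_iff_mul_le, mul_comm]; exact hs
  exact this

include hdeg

lemma P_Stl (v : V) : ∀ᵐ x ∂(P V), ∃ n, Stl Γ n v x := by
  rw [ae_iff]
  have hb : ∀ n : ℕ, P V {x | ¬ ∃ n, Stl Γ n v x} ≤ ENNReal.ofReal ((k:ℝ) ^ n / n.factorial) := by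
    intro n
    obtain ⟨W, hW1, hW2⟩ := paths Γ k hdeg n v
    calc P V {x | ¬ ∃ n, Stl Γ n v x}
        ≤ P V (⋃ w ∈ W, {x | StrictAnti (fun i => x (w i))}) := by
          apply measure_mono
          intro x hx
          obtain ⟨w, hw, _, h⟩ := hW2 x (fun h => hx ⟨n, h⟩)
          exact Set.mem_biUnion hw h
      _ ≤ ∑ w ∈ W, P V {x | StrictAnti (fun i => x (w i))} := measure_biUnion_finset_le _ _
      _ ≤ ∑ w ∈ W, ((n+1).factorial : ENNReal)⁻¹ := Finset.sum_le_sum fun w _ => P_anti n w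
      _ = W.card * ((n+1).factorial : ENNReal)⁻¹ := by simp
      _ ≤ (k ^ n : ℕ) * ((n).factorial : ENNReal)⁻¹ := by
          gcongr
          omega
      _ = ENNReal.ofReal ((k:ℝ) ^ n / n.factorial) := by
          rw [ENNReal.ofReal_div_of_pos (by positivity), div_eq_mul_inv]
          congr 1
          · rw [ENNReal.ofReal_pow (by positivity)]; simp
          · simp
  have ht : Tendsto (fun n : ℕ => ENNReal.ofReal ((k:ℝ) ^ n / n.factorial)) atTop (𝓝 0) := by
    rw [← ENNReal.ofReal_zero]
    exact ENNReal.tendsto_ofReal (FloorSemiring.tendsto_pow_div_factorial_atTop (k:ℝ))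
  exact le_antisymm (ge_of_tendsto' ht hb) (zero_le)

omit hdeg

noncomputable def lcol (v : V) (x : V → I) : Fin (k+1) := liminf (fun n => col Γ k n v x) atTop

lemma lcol_eq (v : V) (x : V → I) (h : ∃ n, Stl Γ n v x) :
    ∀ᶠ n in atTop, col Γ k n v x = lcol Γ k v x := by
  obtain ⟨n, hn⟩ := h
  have : lcol Γ k v x = col Γ k n v x := by
    rw [lcol, liminf_congr (v := fun _ => col Γ k n v x)]
    · exact liminf_const _
    · filter_upwards [eventually_ge_atTop n] with m hm using col_stable Γ k n v x hn m hm
  rw [this]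
  filter_upwards [eventually_ge_atTop n] with m hm using col_stable Γ k n v x hn m hm

include hdeg

lemma lcol_meas (v : V) : Measurable (lcol Γ k v) :=
  Measurable.liminf fun n => col_meas Γ k hdeg n v

lemma lcol_ne_aux {u v : V} (h : Γ.Adj v u) (x : V → I) (hlt : x u < x v)
    (hu : ∃ n, Stl Γ n u x) (hv : ∃ n, Stl Γ n v x) : lcol Γ k v x ≠ lcol Γ k u x := by
  obtain ⟨n, h1, h2⟩ := ((lcol_eq Γ k u x hu).and
    ((tendsto_add_atTop_nat 1).eventually (lcol_eq Γ k v x hv))).exists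
  rw [← h1, ← h2]
  exact col_ne Γ k hdeg n u v x h hlt

lemma lcol_ne {u v : V} (h : Γ.Adj u v) : ∀ᵐ x ∂(P V), lcol Γ k u x ≠ lcol Γ k v x := by
  have ht : ∀ᵐ x ∂(P V), x u ≠ x v := by
    rw [ae_iff]; simpa using P_tie h.ne
  filter_upwards [ht, P_Stl Γ k hdeg u, P_Stl Γ k hdeg v] with x hx hu hv
  rcases lt_or_gt_of_ne hx with hlt | hlt
  · exact (lcol_ne_aux Γ k hdeg h.symm x hlt hu hv).symm
  · exact lcol_ne_aux Γ k hdeg h x hlt hv hu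

omit hdeg

lemma col_equiv {G : Type} [Group G] [MulAction G V]
    (hadj : ∀ (g : G) (u v : V), Γ.Adj (g • u) (g • v) ↔ Γ.Adj u v) (g : G) (n : ℕ) :
    ∀ (v : V) (x : V → I), col Γ k n v (fun w => x (g • w)) = col Γ k n (g • v) x := by
  induction n with
  | zero => intro v x; rfl
  | succ n ih =>
    intro v x
    simp only [col]
    congr 1
    ext i
    constructor
    · rintro ⟨u, hu, hlt, he⟩
      exact ⟨g • u, (hadj g v u).2 hu, hlt, by rw [← ih]; exact he⟩
    · rintro ⟨u, hu, hlt, he⟩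
      refine ⟨g⁻¹ • u, (hadj g v _).1 (by simpa using hu), by simpa using hlt, ?_⟩
      rw [ih]; simpa using he

end Greedy

end InvCol

open InvCol in
/-- If every vertex of `Γ` has degree at most `k` and there are only
finitely many `G`-orbits of edges of `Γ`, then there is a `G`-invariant Borel probability
measure on the space of `(k+1)`-labelings `V → Fin (k+1)` giving measure zero to each
set `B_e = {c | c u = c v}` (`e = (u,v)` an edge), i.e. supported on proper
`(k+1)`-colorings of `Γ`. -/
theorem invariant_coloring_measure_exists
    {V G : Type} [Group G] [MulAction G V] (Γ : SimpleGraph V) (k : ℕ)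
    [MeasurableSpace (V → Fin (k + 1))] [BorelSpace (V → Fin (k + 1))]
    (hadj : ∀ (g : G) (u v : V), Γ.Adj (g • u) (g • v) ↔ Γ.Adj u v)
    (hdeg : ∀ v : V, (Γ.neighborSet v).Finite ∧ (Γ.neighborSet v).ncard ≤ k)
    (horb : ∃ E₀ : Finset (V × V), ∀ u v : V, Γ.Adj u v →
      ∃ p ∈ E₀, ∃ g : G, (g • p.1 = u ∧ g • p.2 = v) ∨ (g • p.1 = v ∧ g • p.2 = u)) :
    ∃ ν : Measure (V → Fin (k + 1)), IsProbabilityMeasure ν ∧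
      (∀ g : G, Measure.map (fun c (v : V) => c (g⁻¹ • v)) ν = ν) ∧
      (∀ u v : V, Γ.Adj u v → ν {c | c u = c v} = 0) := by
  obtain ⟨ν, hreg, hfin, hint⟩ := exists_ext (P V) (lcol Γ k) (lcol_meas Γ k hdeg)
  have hclopen : ∀ B : Set (V → Fin (k+1)), IsClopen B →
      ν.real B = (P V).real {x | (fun v => lcol Γ k v x) ∈ B} := by
    intro B hB
    let f : C(V → Fin (k+1), ℝ) := ⟨B.indicator 1, by
      exact (IsClopen.continuous_indicator hB continuous_one)⟩
    have h := hint f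
    have hBm : MeasurableSet B := hB.isOpen.measurableSet
    have e1 : ∫ x, f x ∂ν = ν.real B := integral_indicator_one hBm
    have hm : MeasurableSet {x | (fun v => lcol Γ k v x) ∈ B} := by
      have := meas_comp (lcol Γ k) (lcol_meas Γ k hdeg) f (measurableSet_singleton 1)
      convert this using 1
      ext x
      by_cases hx : (fun v => lcol Γ k v x) ∈ B <;> simp [f, hx]
    have e2 : ∫ x, f (fun v => lcol Γ k v x) ∂(P V)
        = (P V).real {x | (fun v => lcol Γ k v x) ∈ B} := by
      rw [← integral_indicator_one hm]
      rfl
    rw [← e1, h, e2]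
  refine ⟨ν, ?_, ?_, ?_⟩
  · have := hclopen Set.univ isClopen_univ
    simp only [Set.mem_univ, Set.ofPred_true, probReal_univ] at this
    constructor
    rw [measureReal_def, ENNReal.toReal_eq_one_iff] at this
    exact this
  · intro g
    let φ : (V → Fin (k+1)) ≃ₜ (V → Fin (k+1)) :=
      { toFun := fun c v => c (g⁻¹ • v)
        invFun := fun c v => c (g • v)
        left_inv := fun c => by ext v; simp
        right_inv := fun c => by ext v; simp
        continuous_toFun := by fun_prop
        continuous_invFun := by fun_prop }
    change Measure.map φ ν = ν
    have : (Measure.map φ ν).Regular := Measure.Regular.map φ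
    apply Measure.ext_of_integral_eq_on_compactlySupported
    intro f
    have hfm : Measurable (fun x => f x) := f.continuous.measurable
    rw [integral_map φ.continuous.measurable.aemeasurable hfm.aestronglyMeasurable]
    have h1 := hint ((f : C(V → Fin (k+1), ℝ)).comp ⟨φ, φ.continuous⟩)
    have h2 := hint (f : C(V → Fin (k+1), ℝ))
    have hP := P_map (V := V) (f := fun v => g⁻¹ • v) (MulAction.injective g⁻¹)
    have h3 : ∫ x, f (fun v => lcol Γ k v x) ∂(P V)
        = ∫ x, f (fun v => lcol Γ k (g⁻¹ • v) x) ∂(P V) := by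
      conv_lhs => rw [← hP]
      have hfm : Measurable (fun x => f (fun v => lcol Γ k v x)) :=
        meas_comp (lcol Γ k) (lcol_meas Γ k hdeg) f
      rw [integral_map
        (measurable_pi_lambda _ fun v => measurable_pi_apply (g⁻¹ • v)).aemeasurable
        hfm.aestronglyMeasurable]
      simp only [lcol, col_equiv Γ k hadj]
    exact h1.trans (h3.symm.trans h2.symm)
  · intro u v huv
    have hB : IsClopen {c : V → Fin (k+1) | c u = c v} := by
      have : Continuous fun c : V → Fin (k+1) => (c u, c v) := by fun_prop
      exact (isClopen_discrete {p : Fin (k+1) × Fin (k+1) | p.1 = p.2}).preimage this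
    have := hclopen _ hB
    have h0 : P V {x | lcol Γ k u x = lcol Γ k v x} = 0 := by
      have := lcol_ne Γ k hdeg huv
      rw [ae_iff] at this
      simpa using this
    have h1 : (P V).real {x | lcol Γ k u x = lcol Γ k v x} = 0 := by
      rw [measureReal_def, h0]; rfl
    rw [← measureReal_eq_zero_iff]
    exact this.trans h1
end

section
/- Suppose every vertex of Γ has degree at most k and that there are only finitely many G-orbits of edges of Γ. Then for every ε > 0 there exists a G-invariant Borel probability measure ν on V → Fin (k+1) such that ν(B_e) ≤ ε for every edge e of Γ. -/
open MeasureTheory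

namespace IACM

open Classical Topology

/-- Random bits: one per vertex per round. -/
def Om (V : Type) : Type := ℕ → V → ZMod 2

noncomputable instance (V : Type) : AddCommGroup (Om V) :=
  inferInstanceAs (AddCommGroup (ℕ → V → ZMod 2))
instance (V : Type) : TopologicalSpace (Om V) :=
  inferInstanceAs (TopologicalSpace (ℕ → V → ZMod 2))
instance (V : Type) : IsTopologicalAddGroup (Om V) :=
  inferInstanceAs (IsTopologicalAddGroup (ℕ → V → ZMod 2))
instance (V : Type) : CompactSpace (Om V) :=
  inferInstanceAs (CompactSpace (ℕ → V → ZMod 2))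
instance (V : Type) : MeasurableSpace (Om V) := borel _
instance (V : Type) : BorelSpace (Om V) := ⟨rfl⟩

lemma haar_prob {A : Type} [AddCommGroup A] [TopologicalSpace A] [IsTopologicalAddGroup A]
    [CompactSpace A] [MeasurableSpace A] [BorelSpace A] :
    ∃ m : Measure A, IsProbabilityMeasure m ∧ m.IsAddHaarMeasure := by
  refine ⟨Measure.addHaarMeasure ⊤, ⟨?_⟩, inferInstance⟩
  have := Measure.addHaarMeasure_self (G := A) (K₀ := ⊤)
  simpa using this

lemma finite_point {A : Type} [AddCommGroup A] [Finite A] [TopologicalSpace A]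
    [DiscreteTopology A] [MeasurableSpace A] [BorelSpace A] (m : Measure A)
    [IsProbabilityMeasure m] [m.IsAddHaarMeasure] (a : A) :
    m {a} = (Nat.card A : ENNReal)⁻¹ := by
  haveI := Fintype.ofFinite A
  have h1 : ∀ b : A, m {b} = m {a} := by
    intro b
    have := measure_preimage_add m (a - b) {a}
    rw [← this]
    congr 1
    ext x
    simp only [Set.mem_singleton_iff, Set.mem_preimage]
    constructor
    · rintro rfl; abel
    · intro h
      have h3 : a - b + x = a - b + b := by rw [h]; abel
      exact add_left_cancel h3
  have h2 : ∑ b : A, m {b} = 1 := by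
    rw [sum_measure_singleton]; simp
  simp only [h1, Finset.sum_const, Finset.card_univ, nsmul_eq_mul] at h2
  rw [Nat.card_eq_fintype_card]
  exact ENNReal.eq_inv_of_mul_eq_one_left (by rwa [mul_comm])

lemma miss_all {O : Type} [AddCommGroup O] [TopologicalSpace O] [IsTopologicalAddGroup O]
    [CompactSpace O] [MeasurableSpace O] [BorelSpace O] (μ : Measure O)
    [IsProbabilityMeasure μ] [μ.IsAddHaarMeasure]
    {A : Type} [AddCommGroup A] [Finite A] [TopologicalSpace A]
    [DiscreteTopology A] (T : ℕ) (f : O →+ (Fin T → A)) (hf : Continuous f)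
    (hs : Function.Surjective f) (a : A) :
    μ {ω | ∀ t, f ω t ≠ a} = (1 - (Nat.card A : ENNReal)⁻¹) ^ T := by
  letI : MeasurableSpace A := borel A
  haveI : BorelSpace A := ⟨rfl⟩
  obtain ⟨m, hm, hm'⟩ := haar_prob (A := A)
  haveI : (μ.map f).IsAddHaarMeasure :=
    Measure.isAddHaarMeasure_map_of_isFiniteMeasure μ f hf hs
  haveI : IsProbabilityMeasure (μ.map f) := Measure.isProbabilityMeasure_map hf.measurable.aemeasurable
  have key : μ.map f = Measure.pi (fun _ : Fin T => m) :=
    Measure.isAddHaarMeasure_eq_of_isProbabilityMeasure _ _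
  have hset : {ω | ∀ t, f ω t ≠ a} = f ⁻¹' (Set.univ.pi fun _ : Fin T => ({a}ᶜ : Set A)) := by
    ext ω; simp
  rw [hset, ← Measure.map_apply hf.measurable, key, Measure.pi_pi]
  · simp [prob_compl_eq_one_sub, finite_point]
  · exact MeasurableSet.univ_pi fun _ => (measurableSet_singleton a).compl

variable {V : Type} (Γ : SimpleGraph V) (k : ℕ)

noncomputable def free (c : V → Fin (k + 1)) (v : V) : Fin (k + 1) :=
  Classical.epsilon fun a => ∀ w, Γ.Adj v w → c w ≠ a

def sel (ω : Om V) (n : ℕ) (v : V) : Prop := ω n v = 1 ∧ ∀ w, Γ.Adj v w → ω n w = 0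

noncomputable def col (ω : Om V) : ℕ → V → Fin (k + 1)
  | 0 => fun _ => 0
  | n + 1 => fun v => if sel Γ ω n v then free Γ k (col ω n) v else col ω n v

lemma free_spec (hdeg : ∀ v : V, (Γ.neighborSet v).Finite ∧ (Γ.neighborSet v).ncard ≤ k)
    (c : V → Fin (k + 1)) (v w : V) (h : Γ.Adj v w) : c w ≠ free Γ k c v := by
  have : ∃ a, ∀ w, Γ.Adj v w → c w ≠ a := by
    by_contra! hcon
    have h1 : (c '' Γ.neighborSet v) = Set.univ := by
      ext a
      obtain ⟨w, hw, e⟩ := hcon a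
      simp only [Set.mem_univ, iff_true]
      exact ⟨w, hw, e⟩
    have h2 := Set.ncard_image_le (f := c) (hdeg v).1
    rw [h1, Set.ncard_univ, Nat.card_eq_fintype_card, Fintype.card_fin] at h2
    have := (hdeg v).2
    omega
  exact Classical.epsilon_spec this w h

lemma not_sel_both {ω : Om V} {n : ℕ} {u v : V} (h : Γ.Adj u v) (hu : sel Γ ω n u)
    (hv : sel Γ ω n v) : False := by
  have := hu.2 v h
  rw [hv.1] at this
  exact one_ne_zero this

lemma good_step (hdeg : ∀ v : V, (Γ.neighborSet v).Finite ∧ (Γ.neighborSet v).ncard ≤ k)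
    (ω : Om V) (n : ℕ) (u v : V) (h : Γ.Adj u v)
    (hg : col Γ k ω n u ≠ col Γ k ω n v ∨ sel Γ ω n u) :
    col Γ k ω (n + 1) u ≠ col Γ k ω (n + 1) v := by
  simp only [col]
  by_cases hu : sel Γ ω n u
  · have hv : ¬ sel Γ ω n v := fun hv => not_sel_both Γ h hu hv
    simp only [hu, hv, if_true, if_false]
    exact (free_spec Γ k hdeg _ _ _ h).symm
  · by_cases hv : sel Γ ω n v
    · simp only [hu, hv, if_true, if_false]
      exact free_spec Γ k hdeg _ _ _ h.symm
    · simp only [hu, hv, if_false]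
      tauto

lemma good (hdeg : ∀ v : V, (Γ.neighborSet v).Finite ∧ (Γ.neighborSet v).ncard ≤ k)
    (ω : Om V) (u v : V) (h : Γ.Adj u v) (t : ℕ) (ht : sel Γ ω t u) (T : ℕ) (hT : t < T) :
    col Γ k ω T u ≠ col Γ k ω T v := by
  induction T, hT using Nat.le_induction with
  | base => exact good_step Γ k hdeg ω t u v h (Or.inr ht)
  | succ n _ ih => exact good_step Γ k hdeg ω n u v h (Or.inl ih)

lemma ev_coord (ω : Om V) (n : ℕ) (v : V) : ∀ᶠ y in 𝓝 ω, y n v = ω n v := by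
  have hc : Continuous (fun y : Om V => y n v) :=
    (continuous_apply v).comp (continuous_apply (A := fun _ : ℕ => V → ZMod 2) n)
  exact ((IsLocallyConstant.iff_continuous _).2 hc).eventually_eq ω

lemma ev_col (hdeg : ∀ v : V, (Γ.neighborSet v).Finite ∧ (Γ.neighborSet v).ncard ≤ k)
    (ω : Om V) (n : ℕ) : ∀ v, ∀ᶠ y in 𝓝 ω, col Γ k y n v = col Γ k ω n v := by
  induction n with
  | zero => intro v; simp [col]
  | succ n ih =>
    intro v
    have h1 := (Filter.eventually_all_finite (hdeg v).1).2 (fun w _ => ih w)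
    have h2 := (Filter.eventually_all_finite (hdeg v).1).2 (fun w _ => ev_coord ω n w)
    filter_upwards [h1, h2, ih v, ev_coord ω n v] with y a1 a2 a3 a4
    have hs : sel Γ y n v ↔ sel Γ ω n v := by
      unfold sel
      rw [a4]
      refine and_congr_right fun _ => forall_congr' fun w => imp_congr_right fun hw => ?_
      rw [a2 w hw]
    have hfr : free Γ k (col Γ k y n) v = free Γ k (col Γ k ω n) v := by
      unfold free
      congr 1
      funext a
      refine propext (forall_congr' fun w => imp_congr_right fun hw => ?_)
      rw [a1 w hw]
    simp only [col, hs, hfr, a3]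

lemma continuous_col (hdeg : ∀ v : V, (Γ.neighborSet v).Finite ∧ (Γ.neighborSet v).ncard ≤ k)
    (n : ℕ) : Continuous fun ω : Om V => col Γ k ω n :=
  continuous_pi fun v => (IsLocallyConstant.iff_continuous _).1
    ((IsLocallyConstant.iff_eventually_eq _).2 fun ω => ev_col Γ k hdeg ω n v)

variable {G : Type} [Group G] [MulAction G V]

def shift (g : G) : Om V →+ Om V where
  toFun ω := fun n v => ω n (g⁻¹ • v)
  map_zero' := rfl
  map_add' _ _ := rfl

lemma continuous_shift (g : G) : Continuous (shift (V := V) g) := by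
  refine continuous_pi fun n => continuous_pi fun v => ?_
  exact (continuous_apply (g⁻¹ • v)).comp (continuous_apply (A := fun _ : ℕ => V → ZMod 2) n)

lemma surj_shift (g : G) : Function.Surjective (shift (V := V) g) := by
  intro ω
  refine ⟨shift g⁻¹ ω, ?_⟩
  funext n v
  change ω n (g⁻¹⁻¹ • g⁻¹ • v) = ω n v
  rw [inv_smul_smul]

lemma forall_nbr (hadj : ∀ (g : G) (u v : V), Γ.Adj (g • u) (g • v) ↔ Γ.Adj u v) (g : G) (v : V)
    (P : V → Prop) : (∀ w, Γ.Adj v w → P (g⁻¹ • w)) ↔ ∀ w, Γ.Adj (g⁻¹ • v) w → P w := by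
  constructor
  · intro h w hw
    have := h (g • w) (by rw [← hadj g⁻¹]; simpa using hw)
    simpa using this
  · intro h w hw
    exact h _ ((hadj _ _ _).2 hw)

lemma col_shift (hadj : ∀ (g : G) (u v : V), Γ.Adj (g • u) (g • v) ↔ Γ.Adj u v) (g : G)
    (ω : Om V) (n : ℕ) : ∀ v, col Γ k (shift g ω) n v = col Γ k ω n (g⁻¹ • v) := by
  induction n with
  | zero => intro v; rfl
  | succ n ih =>
    intro v
    have hs : sel Γ (shift g ω) n v ↔ sel Γ ω n (g⁻¹ • v) :=
      and_congr_right fun _ => forall_nbr Γ hadj g v (fun w => ω n w = 0)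
    have hfr : free Γ k (col Γ k (shift g ω) n) v = free Γ k (col Γ k ω n) (g⁻¹ • v) := by
      unfold free
      congr 1
      funext a
      simp only [ih]
      exact propext (forall_nbr Γ hadj g v (fun w => col Γ k ω n w ≠ a))
    simp only [col, hs, hfr, ih]

def restr (T : ℕ) (S : Set V) : Om V →+ (Fin T → (S → ZMod 2)) where
  toFun ω := fun t s => ω t s
  map_zero' := rfl
  map_add' _ _ := rfl

lemma continuous_restr (T : ℕ) (S : Set V) : Continuous (restr T S) := by
  refine continuous_pi fun n => continuous_pi fun v => ?_
  exact (continuous_apply (v : V)).comp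
    (continuous_apply (A := fun _ : ℕ => V → ZMod 2) (n : ℕ))

lemma surj_restr (T : ℕ) (S : Set V) : Function.Surjective (restr T S) := by
  intro f
  refine ⟨fun n v => if h : n < T ∧ v ∈ S then f ⟨n, h.1⟩ ⟨v, h.2⟩ else 0, ?_⟩
  funext t s
  change (if h : (t : ℕ) < T ∧ (s : V) ∈ S then f ⟨t, h.1⟩ ⟨s, h.2⟩ else 0) = f t s
  simp

lemma no_sel (hdeg : ∀ v : V, (Γ.neighborSet v).Finite ∧ (Γ.neighborSet v).ncard ≤ k)
    (μ : Measure (Om V)) [IsProbabilityMeasure μ] [μ.IsAddHaarMeasure] (T : ℕ) (u : V) :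
    μ {ω | ∀ t < T, ¬ sel Γ ω t u} ≤ (1 - ((2 ^ (k + 1) : ℕ) : ENNReal)⁻¹) ^ T := by
  set S : Set V := insert u (Γ.neighborSet u) with hS
  have hfin : S.Finite := (hdeg u).1.insert u
  haveI : Finite S := hfin
  have hcard : Nat.card (S → ZMod 2) ≤ 2 ^ (k + 1) := by
    rw [Nat.card_fun]
    simp only [Nat.card_zmod]
    refine Nat.pow_le_pow_right (by norm_num) ?_
    have := Set.ncard_insert_le u (Γ.neighborSet u)
    have h2 := (hdeg u).2
    rw [Nat.card_coe_set_eq, hS]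
    omega
  let a : S → ZMod 2 := fun s => if (s : V) = u then 1 else 0
  calc μ {ω | ∀ t < T, ¬ sel Γ ω t u} ≤ μ {ω | ∀ t, restr T S ω t ≠ a} := by
        refine measure_mono fun ω hω t h => hω t t.2 ?_
        constructor
        · have : ω t u = a ⟨u, Set.mem_insert _ _⟩ := congrFun h ⟨u, Set.mem_insert _ _⟩
          simpa [a] using this
        · intro w hw
          have : ω t w = a ⟨w, Set.mem_insert_of_mem _ hw⟩ :=
            congrFun h ⟨w, Set.mem_insert_of_mem _ hw⟩
          simpa [a, hw.ne'] using this
    _ = (1 - (Nat.card (S → ZMod 2) : ENNReal)⁻¹) ^ T :=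
        miss_all μ T _ (continuous_restr T S) (surj_restr T S) a
    _ ≤ _ := by gcongr

end IACM

open IACM in
/-- **Statement 0.** If every vertex of `Γ` has degree at most `k` and there are only
finitely many `G`-orbits of edges of `Γ`, then there is a `G`-invariant Borel probability
measure on the space of `(k+1)`-labelings `V → Fin (k+1)` giving measure at most `ε`
to each set `B_e = {c | c u = c v}` (`e = (u,v)` an edge), for any prescribed `ε > 0`. -/
theorem invariant_almost_coloring_measure_exists
    {V G : Type} [Group G] [MulAction G V] (Γ : SimpleGraph V) (k : ℕ)
    [MeasurableSpace (V → Fin (k + 1))] [BorelSpace (V → Fin (k + 1))]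
    (hadj : ∀ (g : G) (u v : V), Γ.Adj (g • u) (g • v) ↔ Γ.Adj u v)
    (hdeg : ∀ v : V, (Γ.neighborSet v).Finite ∧ (Γ.neighborSet v).ncard ≤ k)
    (horb : ∃ E₀ : Finset (V × V), ∀ u v : V, Γ.Adj u v →
      ∃ p ∈ E₀, ∃ g : G, (g • p.1 = u ∧ g • p.2 = v) ∨ (g • p.1 = v ∧ g • p.2 = u))
    (ε : ℝ) (hε : 0 < ε) :
    ∃ ν : Measure (V → Fin (k + 1)), IsProbabilityMeasure ν ∧
      (∀ g : G, Measure.map (fun c (v : V) => c (g⁻¹ • v)) ν = ν) ∧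
      (∀ u v : V, Γ.Adj u v → ν {c | c u = c v} ≤ ENNReal.ofReal ε) := by
  obtain ⟨μ, hμ, hμ'⟩ := haar_prob (A := Om V)
  have hlt : (1 - ((2 ^ (k + 1) : ℕ) : ENNReal)⁻¹) < 1 :=
    ENNReal.sub_lt_self ENNReal.one_ne_top one_ne_zero
      (ENNReal.inv_ne_zero.2 (ENNReal.natCast_ne_top _))
  have hT := ENNReal.tendsto_pow_atTop_nhds_zero_of_lt_one hlt
  obtain ⟨T, hT⟩ := (hT.eventually (gt_mem_nhds (ENNReal.ofReal_pos.2 hε))).exists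
  have hc := continuous_col Γ k hdeg T
  refine ⟨μ.map fun ω => col Γ k ω T, Measure.isProbabilityMeasure_map hc.measurable.aemeasurable,
    ?_, ?_⟩
  · intro g
    have hg : Continuous (fun (c : V → Fin (k + 1)) (v : V) => c (g⁻¹ • v)) :=
      continuous_pi fun v => continuous_apply _
    haveI : (μ.map (shift (V := V) g)).IsAddHaarMeasure :=
      Measure.isAddHaarMeasure_map_of_isFiniteMeasure μ _ (continuous_shift g) (surj_shift g)
    haveI : IsProbabilityMeasure (μ.map (shift (V := V) g)) :=
      Measure.isProbabilityMeasure_map (continuous_shift g).measurable.aemeasurable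
    have hinv : μ.map (shift (V := V) g) = μ :=
      Measure.isAddHaarMeasure_eq_of_isProbabilityMeasure _ _
    rw [Measure.map_map hg.measurable hc.measurable]
    conv_rhs => rw [← hinv, Measure.map_map hc.measurable (continuous_shift g).measurable]
    congr 1
    funext ω v
    exact (col_shift Γ k hadj g ω T v).symm
  · intro u v huv
    have hm : MeasurableSet {c : V → Fin (k + 1) | c u = c v} :=
      (isClosed_eq (continuous_apply u) (continuous_apply v)).measurableSet
    rw [Measure.map_apply hc.measurable hm]
    refine le_trans (measure_mono ?_) ((no_sel Γ k hdeg μ T u).trans hT.le)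
    intro ω hω t ht hs
    exact good Γ k hdeg ω u v huv t hs T ht hω
end

section
/- For every labeling c : V → Fin n and every pair of adjacent vertices u, v ∈ V, if p(c)(u) = p(c)(v) then c(u) = c(v); equivalently, for every edge e of Γ, the preimage p⁻¹(B_e) is contained in B_e. -/
open MeasureTheory

/-- The recoloring map `p : (V → Fin n) → (V → Fin (n-1))`: labels with value `< n-1`
are unchanged; a vertex labeled `n-1` is relabeled with the least element of
`Fin (n-1)` not occurring among the labels of its neighbors (taking the junk value
`0` if no such element exists, which does not happen when the vertex has at most
`n-2` neighbors). -/
noncomputable def recolor {V : Type} (Γ : SimpleGraph V) {n : ℕ} (hn : 2 ≤ n)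
    (c : V → Fin n) (v : V) : Fin (n - 1) :=
  if h : (c v : ℕ) < n - 1 then ⟨c v, h⟩
  else
    ⟨sInf {m : ℕ | m < n - 1 ∧ ∀ w ∈ Γ.neighborSet v, (c w : ℕ) ≠ m}, by
      rcases Set.eq_empty_or_nonempty
          {m : ℕ | m < n - 1 ∧ ∀ w ∈ Γ.neighborSet v, (c w : ℕ) ≠ m} with he | hne
      · rw [he, Nat.sInf_empty]; omega
      · exact (Nat.sInf_mem hne).1⟩

theorem recolor_aux_not_nbr {V : Type} (Γ : SimpleGraph V) (k n : ℕ) (hn : k + 2 ≤ n) (h2 : 2 ≤ n)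
    (c : V → Fin n) (v : V)
    (hdeg : (Γ.neighborSet v).Finite ∧ (Γ.neighborSet v).ncard ≤ k)
    (hv : ¬ (c v : ℕ) < n - 1) (w : V) (hw : w ∈ Γ.neighborSet v) :
    (c w : ℕ) ≠ (recolor Γ h2 c v : ℕ) := by
  have hne : {m : ℕ | m < n - 1 ∧ ∀ w ∈ Γ.neighborSet v, (c w : ℕ) ≠ m}.Nonempty := by
    by_contra hcon
    rw [Set.not_nonempty_iff_eq_empty] at hcon
    have hsub : Set.Iio (n - 1) ⊆ (fun w => (c w : ℕ)) '' Γ.neighborSet v := by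
      intro m hm
      by_contra hmem
      have : m ∈ {m : ℕ | m < n - 1 ∧ ∀ w ∈ Γ.neighborSet v, (c w : ℕ) ≠ m} :=
        ⟨hm, fun w hw he => hmem ⟨w, hw, he⟩⟩
      rw [hcon] at this
      exact this
    have h1 := Set.ncard_le_ncard hsub (hdeg.1.image _)
    have h3 := Set.ncard_image_le (f := fun w => (c w : ℕ)) hdeg.1
    have h4 : (Set.Iio (n - 1)).ncard = n - 1 := by
      rw [← Finset.coe_Iio, Set.ncard_coe_finset, Nat.card_Iio]
    have h5 := hdeg.2
    omega
  have hm := (Nat.sInf_mem hne).2 w hw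
  unfold recolor
  rw [dif_neg hv]
  exact hm

/-- If every vertex of `Γ` has degree at most `k` and `n ≥ k+2`, then for
every labeling `c : V → Fin n` and adjacent vertices `u, v`, if `p c u = p c v` then
`c u = c v`; equivalently `p⁻¹(B_e) ⊆ B_e` for every edge `e`. -/
theorem recolor_eq_of_eq {V : Type} (Γ : SimpleGraph V) (k n : ℕ) (hn : k + 2 ≤ n)
    (hdeg : ∀ v : V, (Γ.neighborSet v).Finite ∧ (Γ.neighborSet v).ncard ≤ k)
    (c : V → Fin n) (u v : V) (huv : Γ.Adj u v)
    (h : recolor Γ (by omega) c u = recolor Γ (by omega) c v) :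
    c u = c v := by
  have hval := congrArg Fin.val h
  by_cases hu : (c u : ℕ) < n - 1 <;> by_cases hv : (c v : ℕ) < n - 1
  · apply Fin.ext
    unfold recolor at hval
    rw [dif_pos hu, dif_pos hv] at hval
    exact hval
  · exfalso
    refine recolor_aux_not_nbr Γ k n hn (by omega) c v (hdeg v) hv u huv.symm ?_
    rw [← hval]
    unfold recolor
    rw [dif_pos hu]
  · exfalso
    refine recolor_aux_not_nbr Γ k n hn (by omega) c u (hdeg u) hu v huv ?_
    rw [hval]
    unfold recolor
    rw [dif_pos hv]
  · apply Fin.ext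
    have := (c u).isLt
    have := (c v).isLt
    omega
end

section
/- For every Borel probability measure ν on V → Fin n and every edge e of Γ, the pushforward measure p_*ν on V → Fin (n−1) satisfies (p_*ν)(B_e) ≤ ν(B_e), where B_e denotes the corresponding set of labelings in each of the two spaces. -/
open MeasureTheory

theorem recolor_avoid {V : Type} (Γ : SimpleGraph V) {k n : ℕ} (hn : k + 2 ≤ n) (h2 : 2 ≤ n)
    (c : V → Fin n) (v w : V)
    (hdeg : (Γ.neighborSet v).Finite ∧ (Γ.neighborSet v).ncard ≤ k)
    (hv : ¬ (c v : ℕ) < n - 1) (hw : Γ.Adj v w) :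
    (c w : ℕ) ≠ (recolor Γ h2 c v : ℕ) := by
  have hne : {m : ℕ | m < n - 1 ∧ ∀ w ∈ Γ.neighborSet v, (c w : ℕ) ≠ m}.Nonempty := by
    by_contra hcon
    rw [Set.not_nonempty_iff_eq_empty] at hcon
    have hsub : (↑(Finset.range (n - 1)) : Set ℕ) ⊆
        (fun w => (c w : ℕ)) '' Γ.neighborSet v := by
      intro m hm
      by_contra hm'
      have : m ∈ {m : ℕ | m < n - 1 ∧ ∀ w ∈ Γ.neighborSet v, (c w : ℕ) ≠ m} :=
        ⟨by simpa using hm, fun w hw h => hm' ⟨w, hw, h⟩⟩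
      rw [hcon] at this
      exact this
    have h1 := Set.ncard_le_ncard hsub (hdeg.1.image _)
    rw [Set.ncard_coe_finset, Finset.card_range] at h1
    have h3 := Set.ncard_image_le (f := fun w => (c w : ℕ)) hdeg.1
    have h4 := hdeg.2
    omega
  have := (Nat.sInf_mem hne).2 w hw
  simpa only [recolor, dif_neg hv] using this

/-- For every Borel probability measure `ν` on `V → Fin n` and every
edge `e = (u,v)` of `Γ`, the pushforward `p⋆ν` on `V → Fin (n-1)` satisfies
`(p⋆ν)(B_e) ≤ ν(B_e)`. -/
theorem recolor_pushforward_le {V : Type} (Γ : SimpleGraph V) (k n : ℕ) (hn : k + 2 ≤ n)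
    [MeasurableSpace (V → Fin n)] [BorelSpace (V → Fin n)]
    [MeasurableSpace (V → Fin (n - 1))] [BorelSpace (V → Fin (n - 1))]
    (hdeg : ∀ v : V, (Γ.neighborSet v).Finite ∧ (Γ.neighborSet v).ncard ≤ k)
    (ν : Measure (V → Fin n)) (hν : IsProbabilityMeasure ν)
    (u v : V) (huv : Γ.Adj u v) :
    Measure.map (fun (c : V → Fin n) => fun w => recolor Γ (by omega : 2 ≤ n) c w) ν
        {d : V → Fin (n - 1) | d u = d v}
      ≤ ν {c : V → Fin n | c u = c v} := by
  by_cases hm : AEMeasurable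
      (fun (c : V → Fin n) => fun w => recolor Γ (by omega : 2 ≤ n) c w) ν
  · have hB : MeasurableSet {d : V → Fin (n - 1) | d u = d v} :=
      (isClosed_eq (continuous_apply u) (continuous_apply v)).measurableSet
    rw [Measure.map_apply_of_aemeasurable hm hB]
    refine measure_mono fun c hc => ?_
    have h2 : 2 ≤ n := by omega
    have hc' : (recolor Γ h2 c u : ℕ) = recolor Γ h2 c v := congrArg Fin.val hc
    show c u = c v
    by_cases hu : (c u : ℕ) < n - 1 <;> by_cases hv : (c v : ℕ) < n - 1
    · simp only [recolor, dif_pos hu, dif_pos hv] at hc'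
      exact Fin.ext hc'
    · refine absurd ?_ (recolor_avoid Γ hn h2 c v u (hdeg v) hv huv.symm)
      rw [← hc']
      simp only [recolor, dif_pos hu]
    · refine absurd ?_ (recolor_avoid Γ hn h2 c u v (hdeg u) hu huv)
      rw [hc']
      simp only [recolor, dif_pos hv]
    · apply Fin.ext
      have := (c u).2
      have := (c v).2
      omega
  · rw [Measure.map_of_not_aemeasurable hm]
    simp
end

section
/- Let μ_n be the product over V of the uniform probability measure on Fin n, and let P : (V → Fin n) → (V → Fin (k+1)) be the composite of the recoloring maps reducing the number of colors successively from n to k+1 (the identity when n = k+1). Then for every edge e of Γ, μ_n(B_e) = 1/n and the pushforward satisfies (P_*μ_n)(B_e) ≤ 1/n. -/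
open MeasureTheory
open scoped ENNReal

/-- The composite `P` of the recoloring maps, reducing the number of colors
successively from `k+1+m` down to `k+1` (the identity when `m = 0`). -/
noncomputable def recolorIter {V : Type} (Γ : SimpleGraph V) (k : ℕ) :
    (m : ℕ) → (V → Fin (k + 1 + m)) → V → Fin (k + 1)
  | 0, c => c
  | m + 1, c => recolorIter Γ k m
      (fun v => Fin.cast (by omega) (recolor Γ (by omega : 2 ≤ k + 1 + (m + 1)) c v))

theorem recolor_least_ne {V : Type} (Γ : SimpleGraph V) {n : ℕ} (k : ℕ) (hk : k + 2 ≤ n)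
    (hdeg : ∀ v : V, (Γ.neighborSet v).Finite ∧ (Γ.neighborSet v).ncard ≤ k)
    (c : V → Fin n) (u v : V) (huv : Γ.Adj u v) :
    sInf {m : ℕ | m < n - 1 ∧ ∀ w ∈ Γ.neighborSet u, (c w : ℕ) ≠ m} ≠ (c v : ℕ) := by
  have hne : {m : ℕ | m < n - 1 ∧ ∀ w ∈ Γ.neighborSet u, (c w : ℕ) ≠ m}.Nonempty := by
    by_contra hcon
    rw [Set.not_nonempty_iff_eq_empty] at hcon
    have hsub : Set.Iio (n - 1) ⊆ (fun w => (c w : ℕ)) '' Γ.neighborSet u := by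
      intro m hm
      by_contra hmem
      have : m ∈ {m : ℕ | m < n - 1 ∧ ∀ w ∈ Γ.neighborSet u, (c w : ℕ) ≠ m} :=
        ⟨hm, fun w hw h => hmem ⟨w, hw, h⟩⟩
      rw [hcon] at this
      exact this
    have h1 := Set.ncard_le_ncard hsub ((hdeg u).1.image _)
    have h2 := Set.ncard_image_le (f := fun w => (c w : ℕ)) (hdeg u).1
    have h3 : (Set.Iio (n - 1)).ncard = n - 1 := by
      rw [← Finset.coe_Iio, Set.ncard_coe_finset, Nat.card_Iio]
    have h4 := (hdeg u).2
    omega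
  exact fun h => (Nat.sInf_mem hne).2 v huv h.symm

theorem recolor_eq_imp {V : Type} (Γ : SimpleGraph V) {n : ℕ} (hn : 2 ≤ n) (k : ℕ) (hk : k + 2 ≤ n)
    (hdeg : ∀ v : V, (Γ.neighborSet v).Finite ∧ (Γ.neighborSet v).ncard ≤ k)
    (c : V → Fin n) (u v : V) (huv : Γ.Adj u v)
    (h : recolor Γ hn c u = recolor Γ hn c v) : c u = c v := by
  have hu := recolor_least_ne Γ k hk hdeg c u v huv
  have hv := recolor_least_ne Γ k hk hdeg c v u huv.symm
  have h' := congrArg Fin.val h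
  have b1 := (c u).isLt
  have b2 := (c v).isLt
  unfold recolor at h'
  apply Fin.ext
  split_ifs at h' with h1 h2 h2
  · exact h'
  · exact absurd h'.symm hv
  · exact absurd h' hu
  · omega

theorem recolorIter_eq_imp {V : Type} (Γ : SimpleGraph V) (k : ℕ)
    (hdeg : ∀ v : V, (Γ.neighborSet v).Finite ∧ (Γ.neighborSet v).ncard ≤ k)
    (u v : V) (huv : Γ.Adj u v) : ∀ (m : ℕ) (c : V → Fin (k + 1 + m)),
    recolorIter Γ k m c u = recolorIter Γ k m c v → c u = c v
  | 0, _, h => h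
  | m + 1, c, h => by
    have := recolorIter_eq_imp Γ k hdeg u v huv m _ h
    exact recolor_eq_imp Γ _ k (by omega) hdeg c u v huv (Fin.cast_injective _ this)

/-- Let `n = k+1+m ≥ k+1`, suppose every vertex of `Γ` has degree at
most `k`, and let `μ` be the product over `V` of the uniform probability measure on
`Fin n` (characterized by its values `(1/n)^|s|` on the cylinders determined by finitely
many coordinates `s`).  Then for every edge `e = (u,v)` of `Γ`, `μ(B_e) = 1/n`, and the
pushforward under the composite recoloring map `P` satisfies `(P⋆μ)(B_e) ≤ 1/n`. -/
theorem uniform_measure_edge_eq_and_pushforward_le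
    {V : Type} (Γ : SimpleGraph V) (k m : ℕ)
    [MeasurableSpace (V → Fin (k + 1 + m))] [BorelSpace (V → Fin (k + 1 + m))]
    [MeasurableSpace (V → Fin (k + 1))] [BorelSpace (V → Fin (k + 1))]
    (hdeg : ∀ v : V, (Γ.neighborSet v).Finite ∧ (Γ.neighborSet v).ncard ≤ k)
    (μ : Measure (V → Fin (k + 1 + m))) (hμ : IsProbabilityMeasure μ)
    (hprod : ∀ (s : Finset V) (f : V → Fin (k + 1 + m)),
      μ {c | ∀ v ∈ s, c v = f v} = (((k + 1 + m : ℕ) : ℝ≥0∞))⁻¹ ^ s.card)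
    (u v : V) (huv : Γ.Adj u v) :
    μ {c : V → Fin (k + 1 + m) | c u = c v} = (((k + 1 + m : ℕ) : ℝ≥0∞))⁻¹ ∧
      Measure.map (recolorIter Γ k m) μ {d : V → Fin (k + 1) | d u = d v}
        ≤ (((k + 1 + m : ℕ) : ℝ≥0∞))⁻¹ := by
  have key : μ {c : V → Fin (k + 1 + m) | c u = c v} = (((k + 1 + m : ℕ) : ℝ≥0∞))⁻¹ := by
    classical
    have hset : {c : V → Fin (k + 1 + m) | c u = c v}
        = ⋃ a : Fin (k + 1 + m), {c | ∀ w ∈ ({u, v} : Finset V), c w = (fun _ => a) w} := by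
      ext c
      simp only [Set.mem_ofPred_eq, Set.mem_iUnion, Finset.mem_insert, Finset.mem_singleton,
        forall_eq_or_imp, forall_eq]
      exact ⟨fun h => ⟨c v, h, rfl⟩, fun ⟨a, h1, h2⟩ => h1.trans h2.symm⟩
    rw [hset, measure_iUnion, tsum_fintype]
    · simp only [hprod, Finset.card_pair huv.ne, Finset.sum_const, Finset.card_univ,
        Fintype.card_fin, nsmul_eq_mul]
      rw [pow_two, ← mul_assoc, ENNReal.mul_inv_cancel, one_mul]
      · exact Nat.cast_ne_zero.mpr (by omega)
      · exact ENNReal.natCast_ne_top _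
    · intro a b hab
      refine Set.disjoint_left.mpr fun c h1 h2 => hab ?_
      exact (h1 u (by simp)).symm.trans (h2 u (by simp))
    · intro a
      apply IsClosed.measurableSet
      simp only [Set.ofPred_forall]
      exact isClosed_biInter fun w _ => isClosed_eq (continuous_apply w) continuous_const
  refine ⟨key, ?_⟩
  by_cases hP : AEMeasurable (recolorIter Γ k m) μ
  · rw [Measure.map_apply_of_aemeasurable hP
      (isClosed_eq (continuous_apply u) (continuous_apply v)).measurableSet, ← key]
    exact measure_mono fun c hc => recolorIter_eq_imp Γ k hdeg u v huv m c hc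
  · rw [Measure.map_of_not_aemeasurable hP]
    simp
end

section
/- Every simple graph in which every vertex has degree at most k (i.e., every neighbor set is finite with at most k elements) admits a proper (k+1)-coloring; that is, such a graph is (k+1)-colorable. The graph is not assumed to be finite. -/
/-- Every simple graph (not assumed finite) in which every vertex has
degree at most `k` (every neighbor set is finite with at most `k` elements) admits a
proper `(k+1)`-coloring. -/
theorem colorable_of_degree_le {V : Type} (Γ : SimpleGraph V) (k : ℕ)
    (hdeg : ∀ v : V, (Γ.neighborSet v).Finite ∧ (Γ.neighborSet v).ncard ≤ k) :
    Γ.Colorable (k + 1) := by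
  classical
  have wf : WellFounded (WellOrderingRel (α := V)) := WellOrderingRel.isWellOrder.wf
  let F : ∀ v : V, (∀ u, WellOrderingRel u v → Fin (k + 1)) → Fin (k + 1) := fun v ih =>
    if h : ∃ x, ∀ u (hr : WellOrderingRel u v), Γ.Adj v u → ih u hr ≠ x then h.choose else 0
  let c : V → Fin (k + 1) := wf.fix F
  have key : ∀ v u, WellOrderingRel u v → Γ.Adj v u → c u ≠ c v := by
    intro v
    have hex : ∃ x, ∀ u (_ : WellOrderingRel u v), Γ.Adj v u → c u ≠ x := by
      by_contra! hcon
      have hsub : (Set.univ : Set (Fin (k + 1))) ⊆ c '' Γ.neighborSet v := by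
        intro x _
        obtain ⟨u, _, ha, hx⟩ := hcon x
        exact ⟨u, ha, hx⟩
      have h1 := Set.ncard_le_ncard hsub ((hdeg v).1.image c)
      have h2 := Set.ncard_image_le (f := c) (hdeg v).1
      have h3 := (hdeg v).2
      rw [Set.ncard_univ, Nat.card_fin] at h1
      omega
    have hc : c v = hex.choose := by
      have h1 : c v = F v (fun u _ => c u) := wf.fix_eq F v
      rw [h1]
      exact dif_pos hex
    rw [hc]
    exact hex.choose_spec
  refine ⟨SimpleGraph.Coloring.mk c ?_⟩
  intro v w h
  rcases trichotomous_of (WellOrderingRel (α := V)) v w with h1 | h1 | h1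
  · exact key w v h1 h.symm
  · exact absurd h1 h.ne
  · exact (key v w h1 h).symm
end

section
/- Let A be an m × d matrix with integer entries. If there exists a vector x : Fin d → ℝ with x i ≥ 0 for all i, x ≠ 0, and A·x = 0 (where the entries of A are coerced to ℝ), then there exists a vector y : Fin d → ℕ with y ≠ 0 such that A·y = 0 (viewing y as an integer vector). In other words, a finite homogeneous system of linear equations with integer coefficients that has a nonzero nonnegative real solution also has a nonzero nonnegative integer solution. -/
theorem exists_nonneg_int_solution_of_nonneg_real_solution
    (m d : ℕ) (A : Matrix (Fin m) (Fin d) ℤ)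
    (x : Fin d → ℝ) (hx : ∀ i, 0 ≤ x i) (hx0 : x ≠ 0)
    (hAx : (A.map (Int.cast : ℤ → ℝ)).mulVec x = 0) :
    ∃ y : Fin d → ℕ, y ≠ 0 ∧ A.mulVec (fun i => (y i : ℤ)) = 0 := by
  classical
  let V : Submodule ℚ ℝ := Submodule.span ℚ (Set.range x)
  have hfin : FiniteDimensional ℚ V := FiniteDimensional.span_of_finite ℚ (Set.finite_range x)
  let v : Fin d → V := fun i => ⟨x i, Submodule.subset_span ⟨i, rfl⟩⟩
  let B := Module.finBasis ℚ V
  have hv : ∀ i, x i = ∑ j, ((B.repr (v i) j : ℚ) : ℝ) * (B j : ℝ) := by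
    intro i
    have h := congrArg (Subtype.val) (B.sum_repr (v i))
    simp only [Submodule.coe_sum, Submodule.coe_smul, Rat.smul_def] at h
    exact h.symm
  let U : Set (Fin (Module.finrank ℚ V) → ℝ) :=
    ⋂ i : {i // 0 < x i}, {t | 0 < ∑ j, ((B.repr (v i) j : ℚ) : ℝ) * t j}
  have hU : IsOpen U := by
    refine isOpen_iInter_of_finite fun i => ?_
    exact isOpen_lt continuous_const (by fun_prop)
  have hUb : (fun j => (B j : ℝ)) ∈ U := by
    refine Set.mem_iInter.2 fun i => ?_
    show 0 < ∑ j, ((B.repr (v i) j : ℚ) : ℝ) * (B j : ℝ)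
    rw [← hv]; exact i.2
  have hD : DenseRange (Pi.map (fun (_ : Fin (Module.finrank ℚ V)) (q : ℚ) => (q : ℝ))) :=
    DenseRange.piMap fun _ => Rat.denseRange_cast
  obtain ⟨t, ht⟩ := hD.exists_mem_open hU ⟨_, hUb⟩
  let φ : V →ₗ[ℚ] ℚ := B.constr ℚ t
  have hφ : ∀ i, φ (v i) = ∑ j, B.repr (v i) j * t j := by
    intro i
    simp [φ, Module.Basis.constr_apply_fintype]
  have hpos : ∀ i, 0 < x i → 0 < φ (v i) := by
    intro i hi
    have h := Set.mem_iInter.1 ht ⟨i, hi⟩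
    simp only [Set.mem_setOf_eq, Pi.map_apply] at h
    rw [hφ]
    exact_mod_cast h
  have hnn : ∀ i, 0 ≤ φ (v i) := by
    intro i
    rcases (hx i).lt_or_eq with h | h
    · exact (hpos i h).le
    · have : v i = 0 := Subtype.ext h.symm
      simp [this]
  let N : ℕ := ∏ i, (φ (v i)).den
  have hN : N ≠ 0 := Finset.prod_ne_zero_iff.2 fun i _ => (φ (v i)).den_nz
  have hy : ∀ i, ∃ n : ℕ, (n : ℚ) = N * φ (v i) := by
    intro i
    obtain ⟨c, hc⟩ : (φ (v i)).den ∣ N := Finset.dvd_prod_of_mem _ (Finset.mem_univ i)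
    have hnum : (((φ (v i)).num.toNat : ℤ)) = (φ (v i)).num :=
      Int.toNat_of_nonneg (Rat.num_nonneg.2 (hnn i))
    refine ⟨c * (φ (v i)).num.toNat, ?_⟩
    have h2 : (((φ (v i)).num.toNat : ℕ) : ℚ) = (φ (v i)).num := by exact_mod_cast hnum
    rw [hc]
    push_cast
    rw [h2, ← Rat.mul_den_eq_num]
    ring
  choose y hy using hy
  refine ⟨y, ?_, ?_⟩
  · obtain ⟨i, hi⟩ := Function.ne_iff.1 hx0
    have hp := hpos i (lt_of_le_of_ne (hx i) (Ne.symm hi))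
    intro h0
    have h1 := hy i
    rw [h0] at h1
    have : (N : ℚ) ≠ 0 := by exact_mod_cast hN
    simp at h1
    rcases h1 with h1 | h1
    · exact hN h1
    · exact hp.ne' h1
  · funext r
    have h1 : ∑ i, (A r i : ℚ) • v i = 0 := by
      apply Subtype.ext
      have := congrFun hAx r
      simp only [Matrix.mulVec, dotProduct, Matrix.map_apply, Pi.zero_apply] at this
      simp only [Submodule.coe_sum, Submodule.coe_smul, Rat.smul_def, Rat.cast_intCast]
      exact this
    have h2 := congrArg φ h1
    simp only [map_sum, map_smul, map_zero, smul_eq_mul] at h2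
    have h3 : ∑ i, (A r i : ℚ) * (y i : ℚ) = 0 := by
      calc _ = N * ∑ i, (A r i : ℚ) * φ (v i) := by
            rw [Finset.mul_sum]
            refine Finset.sum_congr rfl fun i _ => ?_
            rw [hy]; ring
        _ = 0 := by rw [h2, mul_zero]
    simp only [Matrix.mulVec, dotProduct, Pi.zero_apply]
    exact_mod_cast h3
end

section
/- Fix v ∈ V and j ≥ 1. If c, d, c', d' : V → {1, …, k+1} satisfy c(v) = j, c' agrees with c on the ball of radius j−1 about v, and d' agrees with d on the ball of radius j−1 about v, then (v,c) ≃ (v,d) if and only if (v,c') ≃ (v,d'). That is, whether (v,c) ≃ (v,d) holds depends only on the restrictions of c and d to the ball of radius c(v)−1 about v. -/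
/-- The inductively defined relation `(v,c) ≃ (v,d)` of Section 6 of the paper (for a
single graph): `(v,c) ≃ (v,d)` holds if and only if `c v = d v` and, for every vertex
`w` adjacent to `v` with `c w < c v` or `d w < c v`, one has `(w,c) ≃ (w,d)`.
The definition is by well-founded recursion on `min (c v) (d v)`. -/
def colorRel {V : Type} (Γ : SimpleGraph V) (c d : V → ℕ) (v : V) : Prop :=
  if h : c v = d v then
    ∀ w : V, Γ.Adj v w → (c w < c v ∨ d w < c v) → colorRel Γ c d w
  else False
termination_by min (c v) (d v)
decreasing_by
  rename_i hadj hlt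
  omega

theorem colorRel_aux {V : Type} (Γ : SimpleGraph V) (c d c' d' : V → ℕ)
    (hc : ∀ w, 1 ≤ c w) (hd : ∀ w, 1 ≤ d w)
    (hc' : ∀ w, 1 ≤ c' w) (hd' : ∀ w, 1 ≤ d' w) (n : ℕ) :
    ∀ v, c v ≤ n → (∀ w (p : Γ.Walk v w), p.length ≤ n - 1 → c' w = c w ∧ d' w = d w) →
      (colorRel Γ c d v ↔ colorRel Γ c' d' v) := by
  induction n with
  | zero => intro v hv; have := hc v; omega
  | succ n ih =>
    intro v hv h
    obtain ⟨h1, h2⟩ := h v SimpleGraph.Walk.nil (by simp)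
    rw [colorRel.eq_1 Γ c d v, colorRel.eq_1 Γ c' d' v, h1, h2]
    by_cases hcd : c v = d v
    · rw [dif_pos hcd, dif_pos hcd]
      refine forall_congr' fun w => forall_congr' fun hw => ?_
      rcases Nat.eq_zero_or_pos n with hn | hn
      · have := hc w
        have := hd w
        have := hc' w
        have := hd' w
        constructor <;> intro _ hh <;> omega
      · obtain ⟨h3, h4⟩ := h w (SimpleGraph.Walk.cons hw SimpleGraph.Walk.nil) (by simp; omega)
        rw [h3, h4]
        refine forall_congr' fun hlt => ?_
        by_cases hw2 : c w = d w
        · refine ih w (by omega) fun u p hp => h u (SimpleGraph.Walk.cons hw p) ?_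
          rw [SimpleGraph.Walk.length_cons]; omega
        · rw [colorRel.eq_1 Γ c d w, colorRel.eq_1 Γ c' d' w, h3, h4, dif_neg hw2, dif_neg hw2]
    · rw [dif_neg hcd, dif_neg hcd]

/-- For `c, d, c', d' : V → {1,…,k+1}` with `c v = j ≥ 1`, if `c'`
agrees with `c` and `d'` agrees with `d` on the ball of radius `j-1` about `v`
(the set of vertices reachable from `v` at graph distance at most `j-1`), then
`(v,c) ≃ (v,d)` if and only if `(v,c') ≃ (v,d')`: whether `(v,c) ≃ (v,d)` holds depends
only on the restrictions of `c` and `d` to the ball of radius `c v − 1` about `v`. -/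
theorem colorRel_depends_only_on_ball {V : Type} (Γ : SimpleGraph V) (k : ℕ)
    (v : V) (j : ℕ) (hj : 1 ≤ j) (c d c' d' : V → ℕ)
    (hc : ∀ w, 1 ≤ c w ∧ c w ≤ k + 1) (hd : ∀ w, 1 ≤ d w ∧ d w ≤ k + 1)
    (hc' : ∀ w, 1 ≤ c' w ∧ c' w ≤ k + 1) (hd' : ∀ w, 1 ≤ d' w ∧ d' w ≤ k + 1)
    (hcv : c v = j)
    (hcc' : ∀ w, Γ.Reachable v w → Γ.dist v w ≤ j - 1 → c' w = c w)
    (hdd' : ∀ w, Γ.Reachable v w → Γ.dist v w ≤ j - 1 → d' w = d w) :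
    colorRel Γ c d v ↔ colorRel Γ c' d' v := by
  exact colorRel_aux Γ c d c' d' (fun w => (hc w).1) (fun w => (hd w).1) (fun w => (hc' w).1)
    (fun w => (hd' w).1) j v hcv.le fun w p hp =>
      ⟨hcc' w p.reachable ((SimpleGraph.dist_le p).trans hp),
        hdd' w p.reachable ((SimpleGraph.dist_le p).trans hp)⟩
end
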